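/- arXiv:1402.4419 — 3 statements merged into one kernel-verified Lean document; each statement's English description precedes it below -/
import Mathlib

section
/- Let Θ ⊆ ℝ^p be a convex set, f : ℝ^p → ℝ be μ-strongly convex for some μ > 0 and bounded below on Θ, and θ* be a minimizer of f over Θ with f* := f(θ*). Let θ₀ ∈ Θ and for every n ≥ 1 let g_n ∈ S_L(f, θ_{n−1}) be a first-order surrogate of f near θ_{n−1} in Θ, and let θ_n be a minimizer of g_n over Θ. Then for all n ≥ 1, f(θ_n) − f* ≤ β^n (f(θ₀) − f*), where β := L/μ if μ > 2L and β := 1 − μ/(4L) otherwise. -/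
open MeasureTheory Filter Set
open scoped BigOperators NNReal Topology

noncomputable section

/-- `ℝ^p` with the Euclidean structure. -/
abbrev E (p : ℕ) := EuclideanSpace ℝ (Fin p)

/-- A function `h` is `L`-smooth when it is differentiable and its gradient is
`L`-Lipschitz continuous. -/
def LSmooth {p : ℕ} (L : ℝ) (h : E p → ℝ) : Prop :=
  Differentiable ℝ h ∧ LipschitzWith L.toNNReal (gradient h)

/-- `g` is `ρ`-strongly convex: `θ ↦ g θ - (ρ/2)‖θ‖²` is convex. -/
def StrongConvex {p : ℕ} (ρ : ℝ) (g : E p → ℝ) : Prop :=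
  ConvexOn ℝ Set.univ (fun θ => g θ - ρ / 2 * ‖θ‖ ^ 2)

/-- `g` is a first-order surrogate of `f` near `κ` in `Θ` (`g ∈ S_L(f,κ)`):
(i) `g θ' ≥ f θ'` for every minimizer `θ'` of `g` over `Θ`; (ii) the
approximation error `h := g - f` is `L`-smooth, `h κ = 0` and `∇h κ = 0`. -/
def Surrogate {p : ℕ} (L : ℝ) (f g : E p → ℝ) (Θ : Set (E p)) (κ : E p) : Prop :=
  (∀ θ' ∈ Θ, IsMinOn g Θ θ' → f θ' ≤ g θ') ∧
  LSmooth L (fun θ => g θ - f θ) ∧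
  g κ - f κ = 0 ∧ gradient (fun θ => g θ - f θ) κ = 0

/-- `g` is a majorizing first-order surrogate of `f` near `κ`:
`g ≥ f` everywhere and the error `h := g - f` is `L`-smooth, `h κ = 0`, `∇h κ = 0`. -/
def MajSurrogate {p : ℕ} (L : ℝ) (f g : E p → ℝ) (κ : E p) : Prop :=
  (∀ θ, f θ ≤ g θ) ∧
  LSmooth L (fun θ => g θ - f θ) ∧
  g κ - f κ = 0 ∧ gradient (fun θ => g θ - f θ) κ = 0

/-- `l` is the directional derivative `∇f(θ, d) = lim_{t→0⁺} (f(θ + t d) - f θ)/t`. -/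
def HasDirDeriv {p : ℕ} (f : E p → ℝ) (θ d : E p) (l : ℝ) : Prop :=
  Tendsto (fun t : ℝ => (f (θ + t • d) - f θ) / t) (𝓝[>] (0:ℝ)) (𝓝 l)

/-- The asymptotic stationary point condition
`liminf_{n→∞} inf_{θ ∈ Θ, θ ≠ θₙ} ∇f(θₙ, θ - θₙ)/‖θ - θₙ‖ ≥ 0`, where `df θ d`
denotes the directional derivative `∇f(θ, d)`, unfolded in ε-N form. -/
def AsympStationary {p : ℕ} (Θ : Set (E p)) (df : E p → E p → ℝ) (θseq : ℕ → E p) : Prop :=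
  ∀ ε > 0, ∃ N : ℕ, ∀ n ≥ N, ∀ θ ∈ Θ, θ ≠ θseq n →
    df (θseq n) (θ - θseq n) / ‖θ - θseq n‖ ≥ -ε

/-- A smooth function vanishing to first order at `κ` is bounded by a quadratic. -/
lemma LSmooth.le_quadratic {p : ℕ} {L : ℝ} (hL : 0 ≤ L) {h : E p → ℝ} (hh : LSmooth L h)
    {κ : E p} (h0 : h κ = 0) (hgrad : gradient h κ = 0) (θ : E p) :
    h θ ≤ L / 2 * ‖θ - κ‖ ^ 2 := by
  obtain ⟨hd, hlip⟩ := hh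
  set v := θ - κ with hv
  have hderiv (t : ℝ) :
      HasDerivAt (fun t : ℝ => h (κ + t • v)) (inner ℝ (gradient h (κ + t • v)) v) t := by
    have hline : HasDerivAt (fun t : ℝ => κ + t • v) v t := by
      simpa using ((hasDerivAt_id t).smul_const v).const_add κ
    have hf := (hd (κ + t • v)).hasGradientAt.hasFDerivAt
    exact (hf.comp_hasDerivAt t hline).congr_deriv (by simp)
  have hquad (t : ℝ) :
      HasDerivAt (fun t : ℝ => L / 2 * ‖v‖ ^ 2 * t ^ 2) (L * ‖v‖ ^ 2 * t) t :=
    ((hasDerivAt_pow 2 t).const_mul (L / 2 * ‖v‖ ^ 2)).congr_deriv (by push_cast; ring)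
  have key := image_le_of_deriv_right_le_deriv_boundary (a := 0) (b := 1)
    (fun t _ => (hderiv t).continuousAt.continuousWithinAt)
    (fun t _ => (hderiv t).hasDerivWithinAt) (by simp [h0])
    (fun t _ => (hquad t).continuousAt.continuousWithinAt)
    (fun t _ => (hquad t).hasDerivWithinAt) (fun t ht => ?_) (right_mem_Icc.2 zero_le_one)
  · simpa [hv] using key
  · have hb := hlip.dist_le_mul (κ + t • v) κ
    rw [dist_eq_norm, dist_eq_norm, hgrad, sub_zero, add_sub_cancel_left, norm_smul,
      Real.norm_of_nonneg ht.1, Real.coe_toNNReal L hL] at hb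
    calc inner ℝ (gradient h (κ + t • v)) v ≤ ‖gradient h (κ + t • v)‖ * ‖v‖ :=
          real_inner_le_norm _ _
      _ ≤ L * (t * ‖v‖) * ‖v‖ := by gcongr
      _ = L * ‖v‖ ^ 2 * t := by ring

/-- Quadratic growth of a strongly convex function away from a minimizer. -/
lemma StrongConvex.quadratic_growth {p : ℕ} {μ : ℝ} {f : E p → ℝ} (hf : StrongConvex μ f)
    {Θ : Set (E p)} (hΘ : Convex ℝ Θ) {x : E p} (hx : x ∈ Θ) (hmin : IsMinOn f Θ x)
    {y : E p} (hy : y ∈ Θ) : μ / 2 * ‖x - y‖ ^ 2 ≤ f y - f x := by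
  have hsc := (strongConvexOn_iff_convex.2 hf).2
  have hle : f x ≤ f y := hmin hy
  by_contra! hlt
  set c := μ / 2 * ‖x - y‖ ^ 2
  have hc : 0 < c := by linarith
  obtain ⟨a, ha, ha1⟩ := exists_between ((div_lt_one hc).2 hlt)
  have ha0 : 0 < a := (div_nonneg (sub_nonneg.2 hle) hc.le).trans_lt ha
  rw [div_lt_iff₀ hc] at ha
  have hcomb : f (a • x + (1 - a) • y) ≤ a * f x + (1 - a) * f y - a * (1 - a) * c :=
    hsc (mem_univ x) (mem_univ y) ha0.le (sub_nonneg.2 ha1.le) (by ring)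
  have hxmin : f x ≤ f (a • x + (1 - a) • y) :=
    hmin (hΘ hx hy ha0.le (sub_nonneg.2 ha1.le) (by ring))
  nlinarith [mul_pos (sub_pos.2 ha1) (sub_pos.2 ha)]

/-- One step of majorization-minimization, compared with a point of the segment joining the
current iterate to the minimizer. -/
lemma Surrogate.descent {p : ℕ} {Θ : Set (E p)} (hΘ : Convex ℝ Θ) {L μ : ℝ} (hL : 0 < L)
    (hμ : 0 < μ) {f g : E p → ℝ} (hsc : StrongConvex μ f) {θstar κ θ : E p}
    (hθstar : θstar ∈ Θ) (hminf : IsMinOn f Θ θstar) (hκ : κ ∈ Θ) (hsur : Surrogate L f g Θ κ)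
    (hθ : θ ∈ Θ) (hmin : IsMinOn g Θ θ) {a : ℝ} (ha : a ∈ Icc (0 : ℝ) 1) :
    f θ - f θstar ≤ (1 - a + a ^ 2 * (L / μ)) * (f κ - f θstar) := by
  obtain ⟨hge, hsmooth, h0, hgrad⟩ := hsur
  obtain ⟨ha0, ha1⟩ := ha
  set z := a • θstar + (1 - a) • κ
  have hz : z - κ = a • (θstar - κ) := by module
  have hgz : g θ ≤ g z := hmin (hΘ hθstar hκ ha0 (sub_nonneg.2 ha1) (by ring))
  have herr := hsmooth.le_quadratic hL.le h0 hgrad z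
  rw [hz, norm_smul, Real.norm_of_nonneg ha0, mul_pow] at herr
  have hfz := (strongConvexOn_iff_convex.2 hsc).2 (mem_univ θstar) (mem_univ κ) ha0
    (sub_nonneg.2 ha1) (by ring)
  simp only [smul_eq_mul] at hfz
  have hmod : 0 ≤ a * (1 - a) * (μ / 2 * ‖θstar - κ‖ ^ 2) :=
    mul_nonneg (mul_nonneg ha0 (sub_nonneg.2 ha1)) (by positivity)
  have hgrowth : L / 2 * (a ^ 2 * ‖θstar - κ‖ ^ 2) ≤ a ^ 2 * (L / μ) * (f κ - f θstar) := by
    calc L / 2 * (a ^ 2 * ‖θstar - κ‖ ^ 2)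
        = a ^ 2 * (L / μ) * (μ / 2 * ‖θstar - κ‖ ^ 2) := by field_simp
      _ ≤ _ := by gcongr; exact hsc.quadratic_growth hΘ hθstar hminf hκ
  linarith [hge θ hθ hmin]

/-- Proposition 2.7 (strongly convex case): for `μ`-strongly convex `f`,
majorization-minimization with surrogates `gₙ ∈ S_L(f, θ_{n-1})` satisfies
`f(θₙ) - f* ≤ βⁿ (f(θ₀) - f*)` with `β = L/μ` if `μ > 2L` and
`β = 1 - μ/(4L)` otherwise. -/
theorem mm_strongly_convex_rate {p : ℕ} (Θ : Set (E p)) (hΘ : Convex ℝ Θ)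
    (L μ : ℝ) (hL : 0 < L) (hμ : 0 < μ) (f : E p → ℝ)
    (hsc : StrongConvex μ f)
    (hbdd : ∃ B, ∀ θ ∈ Θ, B ≤ f θ)
    (θstar : E p) (hθstar : θstar ∈ Θ) (hminf : IsMinOn f Θ θstar)
    (θseq : ℕ → E p) (g : ℕ → E p → ℝ)
    (hθ0 : θseq 0 ∈ Θ)
    (hsur : ∀ n : ℕ, Surrogate L f (g (n+1)) Θ (θseq n))
    (hmem : ∀ n : ℕ, θseq (n+1) ∈ Θ)
    (hmin : ∀ n : ℕ, IsMinOn (g (n+1)) Θ (θseq (n+1))) :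
    ∀ n : ℕ, 1 ≤ n →
      f (θseq n) - f θstar ≤
        (if 2 * L < μ then L / μ else 1 - μ / (4 * L)) ^ n * (f (θseq 0) - f θstar) := by
  intro n _
  have hmemΘ : ∀ n, θseq n ∈ Θ
    | 0 => hθ0
    | n + 1 => hmem n
  have hdescent (k : ℕ) {a : ℝ} (ha : a ∈ Icc (0 : ℝ) 1) :=
    (hsur k).descent hΘ hL hμ hsc hθstar hminf (hmemΘ k) (hmem k) (hmin k) ha
  set β := if 2 * L < μ then L / μ else 1 - μ / (4 * L) with hβ
  have hβ0 : 0 ≤ β := by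
    rw [hβ]
    split_ifs with h
    · positivity
    · rw [sub_nonneg, div_le_one (by positivity)]
      linarith
  have hstep (k : ℕ) : f (θseq (k + 1)) - f θstar ≤ β * (f (θseq k) - f θstar) := by
    rw [hβ]
    split_ifs with h
    · simpa using hdescent k (right_mem_Icc.2 zero_le_one)
    · have ha : μ / (2 * L) ∈ Icc (0 : ℝ) 1 :=
        ⟨by positivity, (div_le_one (by positivity)).2 (not_lt.1 h)⟩
      convert hdescent k ha using 2
      field_simp
      ring
  have hrate (n : ℕ) : f (θseq n) - f θstar ≤ β ^ n * (f (θseq 0) - f θstar) := by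
    induction n with
    | zero => simp
    | succ k ih =>
      calc f (θseq (k + 1)) - f θstar ≤ β * (f (θseq k) - f θstar) := hstep k
        _ ≤ β * (β ^ k * (f (θseq 0) - f θstar)) := by gcongr
        _ = β ^ (k + 1) * (f (θseq 0) - f θstar) := by ring
  exact hrate n
end
end

section
/- Let Θ ⊆ ℝ^p be a convex set, f : ℝ^p → ℝ be μ-strongly convex for some μ > 0 and bounded below on Θ, and θ* be a minimizer of f over Θ with f* := f(θ*). Let θ₀ ∈ Θ, let ρ ≥ L > 0, and for every n ≥ 1 let g_n ∈ S_{L,ρ}(f, θ_{n−1}) be a ρ-strongly convex first-order surrogate of f near θ_{n−1} in Θ, and let θ_n be a minimizer of g_n over Θ. Then for all n ≥ 1, f(θ_n) − f* ≤ (L/(ρ+μ))^{n−1} · L‖θ₀ − θ*‖₂²/2. -/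
open MeasureTheory Filter Set
open scoped BigOperators NNReal Topology

noncomputable section

/-- A minimizer of a `ρ`-strongly convex function over a convex set enjoys quadratic growth. -/
theorem StrongConvex.add_sq_le_of_isMinOn {p : ℕ} {ρ : ℝ} {g : E p → ℝ} {Θ : Set (E p)}
    (hg : StrongConvex ρ g) (hΘ : Convex ℝ Θ) {x y : E p} (hx : x ∈ Θ) (hy : y ∈ Θ)
    (hmin : IsMinOn g Θ x) : g x + ρ / 2 * ‖x - y‖ ^ 2 ≤ g y := by
  have hsc : StrongConvexOn univ ρ g := strongConvexOn_iff_convex.2 hg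
  have key : ∀ t ∈ Ioo (0 : ℝ) 1, g x + ρ / 2 * ‖x - y‖ ^ 2 * (1 - t) ≤ g y := by
    rintro t ⟨ht0, ht1⟩
    have h1 := hsc.2 (mem_univ x) (mem_univ y) (sub_nonneg.2 ht1.le) ht0.le (by ring)
    have h2 : g x ≤ g ((1 - t) • x + t • y) :=
      hmin (hΘ hx hy (sub_nonneg.2 ht1.le) ht0.le (by ring))
    simp only [smul_eq_mul] at h1
    refine le_of_mul_le_mul_left ?_ ht0
    linarith
  have hlim : Tendsto (fun t : ℝ => g x + ρ / 2 * ‖x - y‖ ^ 2 * (1 - t)) (𝓝[>] 0)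
      (𝓝 (g x + ρ / 2 * ‖x - y‖ ^ 2 * (1 - 0))) :=
    ((by fun_prop : Continuous fun t : ℝ => g x + ρ / 2 * ‖x - y‖ ^ 2 * (1 - t)).tendsto
      0).mono_left nhdsWithin_le_nhds
  simpa using le_of_tendsto hlim
    (Filter.mem_of_superset (Ioo_mem_nhdsGT one_pos) key)

/-- An `L`-smooth function with a critical point `x` grows at most quadratically from `x`. -/
theorem LSmooth.le_add_sq_of_gradient_eq_zero {p : ℕ} {L : ℝ} {h : E p → ℝ} (hL : 0 ≤ L)
    (hh : LSmooth L h) {x : E p} (hx : gradient h x = 0) (y : E p) :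
    h y ≤ h x + L / 2 * ‖y - x‖ ^ 2 := by
  have hd (t : ℝ) : HasDerivAt (fun s : ℝ => h (x + s • (y - x)))
      (inner ℝ (gradient h (x + t • (y - x))) (y - x)) t := by
    have hline : HasDerivAt (fun s : ℝ => x + s • (y - x)) (y - x) t := by
      simpa using ((hasDerivAt_id t).smul_const (y - x)).const_add x
    exact (hh.1 _).hasGradientAt.hasFDerivAt.comp_hasDerivAt t hline
  have hB (t : ℝ) : HasDerivAt (fun s : ℝ => h x + L / 2 * ‖y - x‖ ^ 2 * s ^ 2)
      (L * t * ‖y - x‖ ^ 2) t := by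
    refine (((hasDerivAt_pow 2 t).const_mul (L / 2 * ‖y - x‖ ^ 2)).const_add (h x)).congr_deriv ?_
    norm_num
    ring
  have hle : ∀ t ∈ Ico (0 : ℝ) 1,
      inner ℝ (gradient h (x + t • (y - x))) (y - x) ≤ L * t * ‖y - x‖ ^ 2 := by
    rintro t ⟨ht, -⟩
    have hlip := hh.2.norm_sub_le (x + t • (y - x)) x
    rw [hx, sub_zero, add_sub_cancel_left, norm_smul, Real.norm_of_nonneg ht,
      Real.coe_toNNReal L hL] at hlip
    calc inner ℝ (gradient h (x + t • (y - x))) (y - x)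
        ≤ ‖gradient h (x + t • (y - x))‖ * ‖y - x‖ := real_inner_le_norm _ _
      _ ≤ L * (t * ‖y - x‖) * ‖y - x‖ := by gcongr
      _ = L * t * ‖y - x‖ ^ 2 := by ring
  have := image_le_of_deriv_right_le_deriv_boundary
    (fun t _ => (hd t).continuousAt.continuousWithinAt)
    (fun t _ => (hd t).hasDerivWithinAt) (by simp)
    (fun t _ => (hB t).continuousAt.continuousWithinAt)
    (fun t _ => (hB t).hasDerivWithinAt) hle (right_mem_Icc.2 zero_le_one)
  simpa using this

/-- Proposition 2.8 (strongly convex case): for `μ`-strongly convex `f` and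
`ρ`-strongly convex surrogates `gₙ ∈ S_{L,ρ}(f, θ_{n-1})` with `ρ ≥ L`,
`f(θₙ) - f* ≤ (L/(ρ+μ))^(n-1) · L‖θ₀ - θ*‖²/2` for all `n ≥ 1`. -/
theorem mm_strong_surrogate_strongly_convex_rate {p : ℕ} (Θ : Set (E p)) (hΘ : Convex ℝ Θ)
    (L ρ μ : ℝ) (hL : 0 < L) (hρL : L ≤ ρ) (hμ : 0 < μ) (f : E p → ℝ)
    (hsc : StrongConvex μ f)
    (hbdd : ∃ B, ∀ θ ∈ Θ, B ≤ f θ)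
    (θstar : E p) (hθstar : θstar ∈ Θ) (hminf : IsMinOn f Θ θstar)
    (θseq : ℕ → E p) (g : ℕ → E p → ℝ)
    (hθ0 : θseq 0 ∈ Θ)
    (hsur : ∀ n : ℕ, Surrogate L f (g (n+1)) Θ (θseq n))
    (hscg : ∀ n : ℕ, StrongConvex ρ (g (n+1)))
    (hmem : ∀ n : ℕ, θseq (n+1) ∈ Θ)
    (hmin : ∀ n : ℕ, IsMinOn (g (n+1)) Θ (θseq (n+1))) :
    ∀ n : ℕ, 1 ≤ n →
      f (θseq n) - f θstar ≤
        (L / (ρ + μ)) ^ (n - 1) * (L * ‖θseq 0 - θstar‖ ^ 2 / 2) := by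
  have hstep (n : ℕ) : f (θseq (n + 1)) - f θstar + ρ / 2 * ‖θseq (n + 1) - θstar‖ ^ 2 ≤
      L / 2 * ‖θseq n - θstar‖ ^ 2 := by
    obtain ⟨hmaj, hsm, h0, hgrad⟩ := hsur n
    have hfg := hmaj _ (hmem n) (hmin n)
    have hgrow := (hscg n).add_sq_le_of_isMinOn hΘ (hmem n) hθstar (hmin n)
    have herr := hsm.le_add_sq_of_gradient_eq_zero hL.le hgrad θstar
    rw [norm_sub_rev θstar] at herr
    linarith
  have hcontr (n : ℕ) :
      ‖θseq (n + 1) - θstar‖ ^ 2 ≤ L / (ρ + μ) * ‖θseq n - θstar‖ ^ 2 := by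
    have hgrow := hsc.add_sq_le_of_isMinOn hΘ hθstar (hmem n) hminf
    rw [norm_sub_rev θstar] at hgrow
    rw [div_mul_eq_mul_div, le_div_iff₀ (by linarith)]
    linarith [hstep n]
  have hdist (n : ℕ) : ‖θseq n - θstar‖ ^ 2 ≤ (L / (ρ + μ)) ^ n * ‖θseq 0 - θstar‖ ^ 2 :=
    le_geom (u := fun n => ‖θseq n - θstar‖ ^ 2) (div_nonneg hL.le (by linarith)) n
      fun k _ => hcontr k
  intro n hn
  obtain ⟨m, rfl⟩ := Nat.exists_eq_add_of_le' hn
  rw [Nat.add_sub_cancel]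
  calc f (θseq (m + 1)) - f θstar
      ≤ L / 2 * ‖θseq m - θstar‖ ^ 2 := by
        have : 0 ≤ ρ / 2 * ‖θseq (m + 1) - θstar‖ ^ 2 :=
          mul_nonneg (by linarith) (sq_nonneg _)
        linarith [hstep m]
    _ ≤ L / 2 * ((L / (ρ + μ)) ^ m * ‖θseq 0 - θstar‖ ^ 2) := by gcongr; exact hdist m
    _ = (L / (ρ + μ)) ^ m * (L * ‖θseq 0 - θstar‖ ^ 2 / 2) := by ring
end
end

section
/- Let f, g : ℝ^p → ℝ, and define h := g − f. If g and f are both convex and L-smooth for some L > 0, then h is L-smooth, i.e., h is differentiable and its gradient ∇g − ∇f is L-Lipschitz continuous. -/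
open MeasureTheory Filter Set
open scoped BigOperators NNReal Topology

noncomputable section

section Bounds

variable {F : Type*} [NormedAddCommGroup F] [InnerProductSpace ℝ F]

theorem hasDerivAt_comp_add_smul [CompleteSpace F] {f : F → ℝ} (hf : Differentiable ℝ f)
    (x v : F) (t : ℝ) :
    HasDerivAt (fun t : ℝ => f (x + t • v)) (inner ℝ (gradient f (x + t • v)) v) t := by
  have hline : HasDerivAt (fun t : ℝ => x + t • v) v t := by
    simpa using ((hasDerivAt_id t).smul_const v).const_add x
  have h := (hf (x + t • v)).hasGradientAt.hasFDerivAt.comp_hasDerivAt t hline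
  simpa [Function.comp_def] using h

/-- First-order lower bound for a differentiable convex function. -/
theorem ConvexOn.add_inner_gradient_le [CompleteSpace F] {f : F → ℝ}
    (hconv : ConvexOn ℝ univ f) (hf : Differentiable ℝ f) (x v : F) :
    f x + inner ℝ (gradient f x) v ≤ f (x + v) := by
  have hc : ConvexOn ℝ univ (fun t : ℝ => f (x + t • v)) := by
    have h := hconv.comp_affineMap (AffineMap.lineMap x (x + v) : ℝ →ᵃ[ℝ] F)
    simpa [Function.comp_def, AffineMap.lineMap_apply, add_comm] using h
  have h := hc.le_slope_of_hasDerivAt (mem_univ 0) (mem_univ 1) one_pos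
    (hasDerivAt_comp_add_smul hf x v 0)
  simp only [slope_def_field, zero_smul, one_smul, add_zero, sub_zero, div_one] at h
  linarith

/-- Descent lemma: quadratic upper bound for a function with Lipschitz gradient. -/
theorem le_add_inner_gradient_add_sq [CompleteSpace F] {f : F → ℝ} {K : ℝ≥0}
    (hf : Differentiable ℝ f) (hlip : LipschitzWith K (gradient f)) (x v : F) :
    f (x + v) ≤ f x + inner ℝ (gradient f x) v + K / 2 * ‖v‖ ^ 2 := by
  have hd : ∀ t : ℝ, HasDerivAt
      (fun t : ℝ => f (x + t • v) - (t * inner ℝ (gradient f x) v + K / 2 * ‖v‖ ^ 2 * t ^ 2))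
      (inner ℝ (gradient f (x + t • v)) v
        - (inner ℝ (gradient f x) v + K * ‖v‖ ^ 2 * t)) t := by
    intro t
    have h := (hasDerivAt_comp_add_smul hf x v t).sub
      (((hasDerivAt_id t).mul_const (inner ℝ (gradient f x) v)).add
        ((hasDerivAt_pow 2 t).const_mul (K / 2 * ‖v‖ ^ 2)))
    refine h.congr_deriv ?_
    push_cast
    ring
  have hanti := antitoneOn_of_deriv_nonpos (convex_Icc (0 : ℝ) 1)
    (fun t _ => (hd t).continuousAt.continuousWithinAt)
    (fun t _ => (hd t).differentiableAt.differentiableWithinAt) (by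
      intro t ht
      rw [interior_Icc] at ht
      rw [(hd t).deriv, sub_nonpos, ← sub_le_iff_le_add', ← inner_sub_left]
      calc inner ℝ (gradient f (x + t • v) - gradient f x) v
          ≤ ‖gradient f (x + t • v) - gradient f x‖ * ‖v‖ := real_inner_le_norm _ _
        _ ≤ (K * ‖x + t • v - x‖) * ‖v‖ := by gcongr; exact hlip.norm_sub_le _ _
        _ = K * ‖v‖ ^ 2 * t := by
          rw [add_sub_cancel_left, norm_smul, Real.norm_of_nonneg ht.1.le]; ring)
  have h := hanti (left_mem_Icc.2 zero_le_one) (right_mem_Icc.2 zero_le_one) zero_le_one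
  simp only [zero_smul, one_smul, add_zero] at h
  linarith

/-- A vector field `G` that approximates `h` to first order with a two-sided quadratic error
`K / 2 * ‖v‖ ^ 2` is `K`-Lipschitz. -/
theorem lipschitzWith_of_abs_sub_inner_le {h : F → ℝ} {G : F → F} {K : ℝ≥0} (hK : 0 < K)
    (hG : ∀ x v, |h (x + v) - h x - inner ℝ (G x) v| ≤ K / 2 * ‖v‖ ^ 2) :
    LipschitzWith K G := by
  refine LipschitzWith.of_dist_le_mul fun y x => ?_
  rw [dist_eq_norm, dist_eq_norm]
  have hK' : (0 : ℝ) < K := hK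
  set D := G y - G x with hD
  obtain ⟨d, rfl⟩ : ∃ d, y = x + (2 : ℝ) • d := ⟨(2 : ℝ)⁻¹ • (y - x), by simp⟩
  have key : ∀ s : F, inner ℝ D s ≤ K * (‖s‖ ^ 2 + ‖d‖ ^ 2) := by
    intro s
    have h1 := (abs_le.1 (hG x (s + d))).2
    have h2 := (abs_le.1 (hG (x + (2 : ℝ) • d) (s - d))).1
    have h3 := (abs_le.1 (hG x (d - s))).1
    have h4 := (abs_le.1 (hG (x + (2 : ℝ) • d) (-s - d))).2
    rw [show x + (2 : ℝ) • d + (s - d) = x + (s + d) by module] at h2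
    rw [show x + (2 : ℝ) • d + (-s - d) = x + (d - s) by module,
      show -s - d = -(s + d) by abel, norm_neg] at h4
    rw [norm_sub_rev] at h3
    have hp := parallelogram_law_with_norm ℝ s d
    simp only [inner_add_right, inner_sub_right, inner_neg_right] at h1 h2 h3 h4
    rw [hD, inner_sub_left]
    nlinarith
  have hs := key ((2 * K : ℝ)⁻¹ • D)
  rw [inner_smul_right, real_inner_self_eq_norm_sq, norm_smul,
    Real.norm_of_nonneg (by positivity)] at hs
  have hsq : ‖D‖ ^ 2 ≤ (K * (2 * ‖d‖)) ^ 2 := by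
    field_simp at hs
    nlinarith
  have := (sq_le_sq₀ (norm_nonneg D) (by positivity)).1 hsq
  simpa [norm_smul] using this

end Bounds

/-- Lemma A.5 (ii): if `g` and `f` are convex and `L`-smooth, then
`h := g - f` is `L`-smooth, i.e. `h` is differentiable and its gradient
`∇g - ∇f` is `L`-Lipschitz continuous. -/
theorem residual_smooth_convex {p : ℕ} (L : ℝ) (hL : 0 < L)
    (f g : E p → ℝ)
    (hgconv : ConvexOn ℝ Set.univ g) (hfconv : ConvexOn ℝ Set.univ f)
    (hgsm : LSmooth L g) (hfsm : LSmooth L f) :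
    LSmooth L (fun θ => g θ - f θ) ∧
      LipschitzWith L.toNNReal (fun θ => gradient g θ - gradient f θ) := by
  obtain ⟨hg, hglip⟩ := hgsm
  obtain ⟨hf, hflip⟩ := hfsm
  have hgrad : gradient (fun θ => g θ - f θ) = fun θ => gradient g θ - gradient f θ := by
    funext θ
    simp only [gradient]
    rw [fderiv_fun_sub (hg θ) (hf θ), map_sub]
  have hlip : LipschitzWith L.toNNReal (fun θ => gradient g θ - gradient f θ) := by
    refine lipschitzWith_of_abs_sub_inner_le (h := fun θ => g θ - f θ)
      (Real.toNNReal_pos.2 hL) fun x v => ?_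
    have hg₁ := hgconv.add_inner_gradient_le hg x v
    have hf₁ := hfconv.add_inner_gradient_le hf x v
    have hg₂ := le_add_inner_gradient_add_sq hg hglip x v
    have hf₂ := le_add_inner_gradient_add_sq hf hflip x v
    rw [inner_sub_left, abs_le]
    constructor <;> linarith
  exact ⟨⟨hg.sub hf, hgrad ▸ hlip⟩, hlip⟩
end
end
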